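/- Let G be a finite connected simple graph and G′ a connected induced subgraph of G. If I_G possesses a quadratic Gröbner basis, then I_{G′} possesses a quadratic Gröbner basis. -/

import Mathlib

set_option linter.unusedVariables false

open MvPolynomial

universe uv

/-- The monomial `t_a t_b` associated to an edge `{a,b}`. -/
noncomputable def edgeMon {V : Type*} (K : Type*) [Field K] (e : Sym2 V) :
    MvPolynomial V K :=
  Sym2.lift ⟨fun a b => X a * X b, fun _ _ => mul_comm _ _⟩ e

/-- The toric ideal `I_G` of a graph `G`: the kernel of the `K`-algebra map
`K[x_e : e ∈ E(G)] → K[t_v : v ∈ V]`, `x_e ↦ t_a t_b` for `e = {a,b}`. -/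
noncomputable def toricIdeal {V : Type*} (K : Type*) [Field K] (G : SimpleGraph V) :
    Ideal (MvPolynomial G.edgeSet K) :=
  RingHom.ker (MvPolynomial.aeval (R := K) (fun e : G.edgeSet => edgeMon K e.1))

/-- The initial ideal of `I` with respect to a monomial order: the ideal generated by
the leading monomials of the nonzero elements of `I`. -/
noncomputable def initialIdeal {σ : Type uv} {K : Type*} [Field K] (m : MonomialOrder.{uv, uv} σ)
    (I : Ideal (MvPolynomial σ K)) : Ideal (MvPolynomial σ K) :=
  Ideal.span { g | ∃ f ∈ I, f ≠ 0 ∧ ∃ d ∈ f.support,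
    (∀ d' ∈ f.support, m.toSyn d' ≤ m.toSyn d) ∧ g = monomial d (1 : K) }

/-- `I` possesses a quadratic Gröbner basis: for some monomial order, the initial
ideal of `I` is generated by monomials of degree `2`. -/
def HasQuadraticGB {σ : Type uv} {K : Type*} [Field K] (I : Ideal (MvPolynomial σ K)) : Prop :=
  ∃ m : MonomialOrder.{uv, uv} σ, ∃ S : Set (MvPolynomial σ K),
    initialIdeal m I = Ideal.span S ∧ ∀ f ∈ S, ∃ i j : σ, f = X i * X j

/-- The restriction of a monomial order along an injective map of variables. -/
noncomputable def MonomialOrder.comap {σ τ : Type uv} (m : MonomialOrder.{uv, uv} σ) (f : τ → σ)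
    (hf : Function.Injective f) : MonomialOrder.{uv, uv} τ :=
  let g : (τ →₀ ℕ) →+ m.syn := (m.toSyn : (σ →₀ ℕ) →+ m.syn).comp (Finsupp.mapDomain.addMonoidHom f)
  { syn := AddMonoidHom.mrange g
    addCommMonoidSyn := inferInstance
    linearOrderSyn := inferInstance
    toSyn := AddEquiv.ofBijective g.mrangeRestrict
      ⟨fun _ _ h ↦ Finsupp.mapDomain_injective hf (m.toSyn.injective (Subtype.ext_iff.mp h)),
        g.mrangeRestrict_surjective⟩
    toSyn_monotone := by
      intro a b hab
      obtain ⟨c, rfl⟩ := exists_add_of_le hab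
      change m.toSyn (Finsupp.mapDomain f a) ≤ m.toSyn (Finsupp.mapDomain f (a + c))
      rw [Finsupp.mapDomain_add]
      exact m.toSyn_monotone le_self_add
    wellFoundedLT_syn := ⟨InvImage.wf Subtype.val m.wellFoundedLT_syn.wf⟩ }

theorem MonomialOrder.comap_toSyn_le_iff {σ τ : Type uv} (m : MonomialOrder.{uv, uv} σ) (f : τ → σ)
    (hf : Function.Injective f) (a b : τ →₀ ℕ) :
    (m.comap f hf).toSyn a ≤ (m.comap f hf).toSyn b ↔
      m.toSyn (a.mapDomain f) ≤ m.toSyn (b.mapDomain f) :=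
  Iff.rfl

/-- If `rename f` and `killCompl` carry `I` and `J` into each other, then the initial ideal
of `J` is the image of the initial ideal of `I`. -/
theorem initialIdeal_comap {σ τ : Type uv} {K : Type*} [Field K] (m : MonomialOrder.{uv, uv} σ)
    (f : τ → σ) (hf : Function.Injective f) (I : Ideal (MvPolynomial σ K))
    (J : Ideal (MvPolynomial τ K)) (hJI : ∀ p ∈ J, rename f p ∈ I)
    (hIJ : ∀ p ∈ I, killCompl hf p ∈ J) :
    initialIdeal (m.comap f hf) J = (initialIdeal m I).map (killCompl (R := K) hf) := by
  classical
  apply le_antisymm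
  · refine Ideal.span_le.mpr ?_
    rintro _ ⟨p, hp, hp0, d, hd, hmax, rfl⟩
    rw [← killCompl_monomial_mapDomain (f := f) hf]
    refine Ideal.mem_map_of_mem _ (Ideal.subset_span ⟨rename f p, hJI p hp, ?_, d.mapDomain f,
      ?_, ?_, rfl⟩)
    · exact fun h ↦ hp0 (rename_injective f hf (by rw [h, map_zero]))
    · rw [support_rename_of_injective hf]
      exact Finset.mem_image_of_mem _ hd
    · intro d' hd'
      rw [support_rename_of_injective hf] at hd'
      obtain ⟨u, hu, rfl⟩ := Finset.mem_image.mp hd'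
      exact (m.comap_toSyn_le_iff f hf u d).mp (hmax u hu)
  · refine Ideal.map_le_iff_le_comap.mpr (Ideal.span_le.mpr ?_)
    rintro _ ⟨p, hp, hp0, d, hd, hmax, rfl⟩
    change killCompl hf (monomial d (1 : K)) ∈ initialIdeal (m.comap f hf) J
    by_cases hs : (d.support : Set σ) ⊆ Set.range f
    · obtain ⟨u, rfl⟩ : ∃ u : τ →₀ ℕ, u.mapDomain f = d :=
        ⟨_, Finsupp.mapDomain_comapDomain f hf d hs⟩
      rw [killCompl_monomial_mapDomain]
      have hu : u ∈ (killCompl hf p).support := by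
        rw [support_killCompl]
        exact Finset.mem_preimage.mpr hd
      refine Ideal.subset_span ⟨killCompl hf p, hIJ p hp, ?_, u, hu, ?_, rfl⟩
      · rintro h
        simp [h] at hu
      · intro d' hd'
        rw [support_killCompl] at hd'
        exact (m.comap_toSyn_le_iff f hf d' u).mpr (hmax _ (Finset.mem_preimage.mp hd'))
    · rw [killCompl_monomial_eq_zero_of_not_subset hf _ hs]
      exact Ideal.zero_mem _

theorem killCompl_X {σ τ : Type*} {K : Type*} [CommSemiring K] {f : τ → σ}
    (hf : Function.Injective f) (i : τ) : killCompl hf (X (f i) : MvPolynomial σ K) = X i := by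
  rw [← rename_X, killCompl_rename_app]

theorem killCompl_X_of_notMem {σ τ : Type*} {K : Type*} [CommSemiring K] {f : τ → σ}
    (hf : Function.Injective f) {i : σ} (hi : i ∉ Set.range f) :
    killCompl hf (X i : MvPolynomial σ K) = 0 := by
  rw [killCompl, aeval_X, dif_neg hi]

theorem HasQuadraticGB.of_rename_killCompl {σ τ : Type uv} {K : Type*} [Field K]
    (f : τ → σ) (hf : Function.Injective f) (I : Ideal (MvPolynomial σ K))
    (J : Ideal (MvPolynomial τ K)) (hJI : ∀ p ∈ J, rename f p ∈ I)
    (hIJ : ∀ p ∈ I, killCompl hf p ∈ J) (h : HasQuadraticGB I) : HasQuadraticGB J := by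
  obtain ⟨m, S, hS, hS2⟩ := h
  refine ⟨m.comap f hf, (killCompl hf '' S) \ {0}, ?_, ?_⟩
  · rw [initialIdeal_comap m f hf I J hJI hIJ, hS, Ideal.map_span]
    exact Ideal.span_sdiff_singleton_zero.symm
  · rintro _ ⟨⟨_, hg, rfl⟩, hne⟩
    obtain ⟨i, j, rfl⟩ := hS2 _ hg
    rw [Set.mem_singleton_iff, map_mul] at hne
    have hi : i ∈ Set.range f := by
      by_contra hi
      exact hne (by rw [killCompl_X_of_notMem hf hi, zero_mul])
    have hj : j ∈ Set.range f := by
      by_contra hj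
      exact hne (by rw [killCompl_X_of_notMem hf hj, mul_zero])
    obtain ⟨i, rfl⟩ := hi
    obtain ⟨j, rfl⟩ := hj
    exact ⟨i, j, by rw [map_mul, killCompl_X, killCompl_X]⟩

theorem rename_edgeMon {V W : Type*} (K : Type*) [Field K] (f : W → V) (e : Sym2 W) :
    rename f (edgeMon K e) = edgeMon K (e.map f) := by
  induction e with
  | _ a b => simp [edgeMon]

theorem rename_mem_toricIdeal {V W : Type*} (K : Type*) [Field K] {G : SimpleGraph V}
    {H : SimpleGraph W} (φ : H ↪g G) (p : MvPolynomial H.edgeSet K) (hp : p ∈ toricIdeal K H) :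
    rename φ.mapEdgeSet p ∈ toricIdeal K G := by
  have key : (aeval fun e : G.edgeSet ↦ edgeMon K e.1).comp (rename φ.mapEdgeSet) =
      (rename φ).comp (aeval (R := K) fun e : H.edgeSet ↦ edgeMon K e.1) := by
    ext1 e
    simp only [AlgHom.comp_apply, rename_X, aeval_X, rename_edgeMon]
    rfl
  have h := DFunLike.congr_fun key p
  simp only [AlgHom.comp_apply] at h
  exact h.trans ((congrArg (rename φ) hp).trans (map_zero _))

theorem killCompl_mem_toricIdeal {V W : Type*} (K : Type*) [Field K] {G : SimpleGraph V}
    {H : SimpleGraph W} (φ : H ↪g G) (p : MvPolynomial G.edgeSet K) (hp : p ∈ toricIdeal K G) :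
    killCompl φ.mapEdgeSet.injective p ∈ toricIdeal K H := by
  have key : (aeval fun e : H.edgeSet ↦ edgeMon K e.1).comp
      (killCompl φ.mapEdgeSet.injective) =
      (killCompl φ.injective).comp (aeval (R := K) fun e : G.edgeSet ↦ edgeMon K e.1) := by
    ext1 e
    simp only [AlgHom.comp_apply, aeval_X]
    by_cases he : e ∈ Set.range φ.mapEdgeSet
    · obtain ⟨e, rfl⟩ := he
      rw [killCompl_X, aeval_X]
      change _ = killCompl φ.injective (edgeMon K (e.1.map φ))
      rw [← rename_edgeMon, killCompl_rename_app]
    · rw [killCompl_X_of_notMem _ he, map_zero]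
      obtain ⟨e, h_edge⟩ := e
      induction e with
      | _ a b =>
        simp only [edgeMon, Sym2.lift_mk, map_mul]
        by_cases ha : a ∈ Set.range φ
        · by_cases hb : b ∈ Set.range φ
          · obtain ⟨a, rfl⟩ := ha
            obtain ⟨b, rfl⟩ := hb
            exact absurd ⟨⟨s(a, b), φ.map_adj_iff.mp h_edge⟩, rfl⟩ he
          · rw [killCompl_X_of_notMem φ.injective hb, mul_zero]
        · rw [killCompl_X_of_notMem φ.injective ha, zero_mul]
  have h := DFunLike.congr_fun key p
  simp only [AlgHom.comp_apply] at h
  exact h.trans ((congrArg (killCompl φ.injective) hp).trans (map_zero _))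

/-- If `I_G` possesses a quadratic Gröbner basis, then so does the toric ideal of any
connected induced subgraph of `G`. -/
theorem quadGB_induce {V : Type uv} [Fintype V] (K : Type*) [Field K]
    (G : SimpleGraph V) (hG : G.Connected) (s : Set V) (hG' : (G.induce s).Connected)
    (h : HasQuadraticGB (toricIdeal K G)) :
    HasQuadraticGB (toricIdeal K (G.induce s)) :=
  h.of_rename_killCompl _ (SimpleGraph.Embedding.induce s).mapEdgeSet.injective _ _
    (rename_mem_toricIdeal K _) (killCompl_mem_toricIdeal K _)
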